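/- Let m ≥ 2, let t_1, t_m ≥ 1 and t_2, …, t_{m−1} ≥ 0 be integers, and let σ be the substitution on the alphabet {0, 1, …, m−1} defined by σ(k) = 0^{t_{k+1}} (k+1) for 0 ≤ k ≤ m−2 and σ(m−1) = 0^{t_m}, where σ is assumed primitive. Let u = σ^∞(0) be the fixed point of σ beginning with 0. Then u satisfies property R_m if and only if C(n) = (m−1)n + 1 for all n ≥ 0. -/

import Mathlib

variable {A : Type*}

/-- The factor of `u` of length `n` starting at position `j`. -/
def factorAt (u : ℕ → A) (j n : ℕ) : List A :=
  (List.range n).map (fun i => u (j + i))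

/-- `j` is an occurrence of the finite word `w` in `u`. -/
def OccursAt (u : ℕ → A) (w : List A) (j : ℕ) : Prop :=
  factorAt u j w.length = w

/-- `w` is a factor of the infinite word `u`. -/
def IsFactor (u : ℕ → A) (w : List A) : Prop :=
  ∃ j, OccursAt u w j

/-- `v` is a return word of `w` in `u`: the word between two successive occurrences of `w`. -/
def IsReturnWord (u : ℕ → A) (w v : List A) : Prop :=
  ∃ j k, j < k ∧ OccursAt u w j ∧ OccursAt u w k ∧
    (∀ l, j < l → l < k → ¬ OccursAt u w l) ∧ v = factorAt u j (k - j)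

/-- The set `R(w)` of return words of `w` in `u`. -/
def returnWords (u : ℕ → A) (w : List A) : Set (List A) :=
  {v | IsReturnWord u w v}

/-- Property `R_m`: every factor of `u` has exactly `m` return words. -/
def PropertyR (u : ℕ → A) (m : ℕ) : Prop :=
  ∀ w, IsFactor u w → (returnWords u w).Finite ∧ (returnWords u w).ncard = m

/-- The set of left extensions of `w`. -/
def leftExt (u : ℕ → A) (w : List A) : Set A := {a | IsFactor u (a :: w)}

/-- The set of right extensions of `w`. -/
def rightExt (u : ℕ → A) (w : List A) : Set A := {b | IsFactor u (w ++ [b])}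

def LeftSpecial (u : ℕ → A) (w : List A) : Prop := 2 ≤ (leftExt u w).ncard

def RightSpecial (u : ℕ → A) (w : List A) : Prop := 2 ≤ (rightExt u w).ncard

/-- The set of pairs `(a, b)` such that `a w b` is a factor of `u`. -/
def extPairs (u : ℕ → A) (w : List A) : Set (A × A) :=
  {p | IsFactor u (p.1 :: (w ++ [p.2]))}

/-- The bilateral order `B(w)`. -/
noncomputable def bilateralOrder (u : ℕ → A) (w : List A) : ℤ :=
  ((extPairs u w).ncard : ℤ) - (leftExt u w).ncard - (rightExt u w).ncard + 1

/-- `w` is a weak bispecial factor of `u`. -/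
def WeakBispecial (u : ℕ → A) (w : List A) : Prop :=
  IsFactor u w ∧ bilateralOrder u w < 0

/-- The factor complexity of `u`. -/
noncomputable def Complexity (u : ℕ → A) (n : ℕ) : ℕ :=
  {w : List A | w.length = n ∧ IsFactor u w}.ncard

/-- `u` is recurrent: every factor occurs at least twice. -/
def Recurrent (u : ℕ → A) : Prop :=
  ∀ w, IsFactor u w → ∃ j k, j < k ∧ OccursAt u w j ∧ OccursAt u w k

/-- `u` is uniformly recurrent. -/
def UniformlyRecurrent (u : ℕ → A) : Prop :=
  ∀ n : ℕ, ∃ N : ℕ, ∀ w, IsFactor u w → w.length = N →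
    ∀ v, IsFactor u v → v.length = n → v <:+: w

def EventuallyPeriodic (u : ℕ → A) : Prop :=
  ∃ p, 0 < p ∧ ∃ N, ∀ n, N ≤ n → u (n + p) = u n

/-- `w` is a maximal right special factor. -/
def MaximalRightSpecial (u : ℕ → A) (w : List A) : Prop :=
  IsFactor u w ∧ RightSpecial u w ∧
    ∀ v, IsFactor u v → RightSpecial u v → w <:+ v → v = w

/-- The return word `v` of `w` starts with the letter `b`. -/
def StartsWithLetter (w v : List A) (b : A) : Prop := (w ++ [b]) <+: (v ++ w)

/-- Every prefix of `u` can be extended to the left by every letter. -/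
def PrefixesFullyLeftExtendable (u : ℕ → A) : Prop :=
  ∀ (n : ℕ) (a : A), ∃ j, u j = a ∧ ∀ l < n, u (j + 1 + l) = u l

/-- Every left special factor of `u` is a prefix of `u`. -/
def LeftSpecialsArePrefixes (u : ℕ → A) : Prop :=
  ∀ (n i j : ℕ), (∀ l < n, u (i + 1 + l) = u (j + 1 + l)) → u i ≠ u j →
    ∀ l < n, u (i + 1 + l) = u l

@[simp]
theorem length_factorAt (u : ℕ → A) (j n : ℕ) : (factorAt u j n).length = n := by
  simp [factorAt]

@[simp]
theorem getElem_factorAt (u : ℕ → A) (j n i : ℕ) (h : i < (factorAt u j n).length) :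
    (factorAt u j n)[i] = u (j + i) := by
  simp [factorAt]

theorem factorAt_eq_iff {u : ℕ → A} {i j n : ℕ} :
    factorAt u i n = factorAt u j n ↔ ∀ l < n, u (i + l) = u (j + l) := by
  simp [factorAt, List.map_inj_left]

theorem factorAt_add (u : ℕ → A) (j a b : ℕ) :
    factorAt u j (a + b) = factorAt u j a ++ factorAt u (j + a) b := by
  simp [factorAt, List.range_add, Nat.add_assoc]

theorem factorAt_succ_left (u : ℕ → A) (j n : ℕ) :
    factorAt u j (n + 1) = u j :: factorAt u (j + 1) n := by
  rw [Nat.add_comm, factorAt_add]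
  simp [factorAt]

theorem occursAt_cons {u : ℕ → A} {a : A} {w : List A} {j : ℕ} :
    OccursAt u (a :: w) j ↔ u j = a ∧ OccursAt u w (j + 1) := by
  simp [OccursAt, factorAt_succ_left]

theorem OccursAt.iff_agree {u : ℕ → A} {w : List A} {i j : ℕ} (h : OccursAt u w i) :
    OccursAt u w j ↔ ∀ l < w.length, u (j + l) = u (i + l) := by
  unfold OccursAt at *
  rw [← factorAt_eq_iff, h]

theorem OccursAt.of_agree {u : ℕ → A} {w : List A} {i j : ℕ} (h : OccursAt u w i)
    (hj : ∀ l < w.length, u (j + l) = u (i + l)) : OccursAt u w j :=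
  h.iff_agree.2 hj

theorem reverse_factorAt_getElem? {u : ℕ → A} {j k r : ℕ} (hr : r < k - j) :
    (factorAt u j (k - j)).reverse[r]? = some (u (k - 1 - r)) := by
  rw [List.getElem?_reverse (by simpa using hr), List.getElem?_eq_getElem (by simp; omega)]
  simp only [getElem_factorAt, length_factorAt]
  congr 2
  omega

theorem isFactor_iff_exists_first {u : ℕ → A} {w : List A} :
    IsFactor u w ↔ ∃ q, OccursAt u w q ∧ ∀ l < q, ¬ OccursAt u w l := by
  classical
  refine ⟨fun h => ⟨Nat.find h, Nat.find_spec h, fun l hl => Nat.find_min h hl⟩, ?_⟩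
  rintro ⟨q, hq, -⟩
  exact ⟨q, hq⟩

namespace PrefixesFullyLeftExtendable

variable {u : ℕ → A}

theorem exists_prefix_occurrence_ge (H : PrefixesFullyLeftExtendable u) (N : ℕ) :
    ∀ n, ∃ j ≥ N, ∀ l < n, u (j + l) = u l := by
  induction N with
  | zero => exact fun n => ⟨0, le_rfl, by simp⟩
  | succ N ih =>
    intro n
    obtain ⟨i, -, hi⟩ := H n (u 0)
    obtain ⟨j, hj, hj'⟩ := ih (i + 1 + n)
    refine ⟨j + (i + 1), by omega, fun l hl => ?_⟩
    rw [Nat.add_assoc, hj' _ (by omega), hi l hl]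

/-- A position `k` where `w` occurs, without occurrence in `(i, k)`, yields a return word of `w`
ending with `u_i ⋯ u_{k-1}`. -/
theorem exists_returnWord (H : PrefixesFullyLeftExtendable u) {w : List A} {i k : ℕ} (hik : i < k)
    (hk : OccursAt u w k) (hno : ∀ l, i < l → l < k → ¬ OccursAt u w l) :
    ∃ v ∈ returnWords u w, ∀ r < k - i, v.reverse[r]? = some (u (k - 1 - r)) := by
  classical
  obtain ⟨N, hN, hN'⟩ := H.exists_prefix_occurrence_ge (k + 1) (k + w.length)
  have shift : ∀ l ≤ k, OccursAt u w (N + l) ↔ OccursAt u w l := by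
    intro l hl
    rw [hk.iff_agree, hk.iff_agree]
    refine forall₂_congr fun r hr => ?_
    rw [Nat.add_assoc, hN' _ (by omega)]
  obtain ⟨j, hj⟩ : ∃ j, j = Nat.findGreatest (OccursAt u w) (N + i) := ⟨_, rfl⟩
  have hkj : k ≤ j := hj ▸ Nat.le_findGreatest (by omega) hk
  have hjN : j ≤ N + i := hj ▸ Nat.findGreatest_le _
  have hjw : OccursAt u w j := hj ▸ Nat.findGreatest_spec (m := k) (by omega) hk
  refine ⟨factorAt u j (N + k - j), ⟨j, N + k, by omega, hjw, (shift k le_rfl).2 hk, ?_, rfl⟩, ?_⟩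
  · intro l hjl hlk hl
    rcases le_or_gt l (N + i) with h | h
    · exact Nat.findGreatest_is_greatest (hj ▸ hjl) h hl
    · obtain ⟨d, rfl⟩ := Nat.exists_eq_add_of_le (show N ≤ l by omega)
      exact hno d (by omega) (by omega) ((shift d (by omega)).1 hl)
  · intro r hr
    rw [reverse_factorAt_getElem? (by omega), show N + k - 1 - r = N + (k - 1 - r) by omega,
      hN' _ (by omega)]

/-- If `q` is the first occurrence of `w`, there is a return word of `w` ending with
`c u_0 ⋯ u_{q-1}`, for every letter `c`. -/
theorem exists_returnWord_of_letter (H : PrefixesFullyLeftExtendable u) {w : List A} {q : ℕ}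
    (hq : OccursAt u w q) (hmin : ∀ l < q, ¬ OccursAt u w l) (c : A) :
    ∃ v ∈ returnWords u w, v.reverse[q]? = some c ∧
      ∀ r < q, v.reverse[r]? = some (u (q - 1 - r)) := by
  obtain ⟨i, rfl, hi⟩ := H (q + w.length) c
  have shift : ∀ l ≤ q, OccursAt u w (i + 1 + l) ↔ OccursAt u w l := by
    intro l hl
    rw [hq.iff_agree, hq.iff_agree]
    refine forall₂_congr fun r hr => ?_
    rw [Nat.add_assoc (i + 1), hi _ (by omega)]
  obtain ⟨v, hv, hv'⟩ := H.exists_returnWord (i := i) (k := i + 1 + q) (by omega)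
    ((shift q le_rfl).2 hq) (by
      intro l h1 h2 h3
      obtain ⟨d, rfl⟩ := Nat.exists_eq_add_of_le (show i + 1 ≤ l by omega)
      exact hmin d (by omega) ((shift d (by omega)).1 h3))
  refine ⟨v, hv, ?_, fun r hr => ?_⟩
  · rw [hv' q (by omega)]
    congr 2
    omega
  · rw [hv' r (by omega), show i + 1 + q - 1 - r = i + 1 + (q - 1 - r) by omega, hi _ (by omega)]

theorem leftSpecialsArePrefixes_of_propertyR [Fintype A] (H : PrefixesFullyLeftExtendable u)
    (hR : PropertyR u (Fintype.card A)) : LeftSpecialsArePrefixes u := by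
  intro n i j hij hne
  by_contra hpre
  obtain ⟨w, hw⟩ : ∃ w, w = factorAt u (i + 1) n := ⟨_, rfl⟩
  have hlen : w.length = n := by simp [hw]
  have hwi : OccursAt u w (i + 1) := by simp [OccursAt, hw]
  have hwj : OccursAt u w (j + 1) := hwi.of_agree fun l hl => (hij l (hlen ▸ hl)).symm
  obtain ⟨q, hq, hmin⟩ := isFactor_iff_exists_first.1 ⟨_, hwi⟩
  have hq0 : 0 < q := by
    rcases Nat.eq_zero_or_pos q with rfl | h
    · refine absurd (fun l hl => ?_) hpre
      simpa using hq.iff_agree.1 hwi l (hlen ▸ hl)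
    · exact h
  obtain ⟨e, he, hwe⟩ : ∃ e, u e ≠ u (q - 1) ∧ OccursAt u w (e + 1) := by
    by_cases h : u i = u (q - 1)
    · exact ⟨j, fun h' => hne (h.trans h'.symm), hwj⟩
    · exact ⟨i, h, hwi⟩
  obtain ⟨v, hv, hv'⟩ := H.exists_returnWord (Nat.lt_succ_self e) hwe (by omega)
  choose f hf hfq hfr using H.exists_returnWord_of_letter hq hmin
  have hinj : Function.Injective f := fun a b hab => by
    have := hfq a
    rw [hab, hfq b] at this
    exact (Option.some.inj this).symm
  have hvf : v ∉ Set.range f := by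
    rintro ⟨c, rfl⟩
    have h1 := hfr c 0 hq0
    rw [hv' 0 (by omega)] at h1
    exact he (by simpa using h1)
  obtain ⟨hfin, hcard⟩ := hR w ⟨_, hwi⟩
  have hle := Set.ncard_le_ncard (Set.insert_subset hv (Set.range_subset_iff.2 hf)) hfin
  rw [Set.ncard_insert_of_notMem hvf (Set.finite_range f), hcard, ← Set.image_univ,
    Set.ncard_image_of_injective _ hinj, Set.ncard_univ, Nat.card_eq_fintype_card] at hle
  omega

end PrefixesFullyLeftExtendable

namespace LeftSpecialsArePrefixes

variable {u : ℕ → A}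

theorem agree_before (hL : LeftSpecialsArePrefixes u) {w : List A} {q j k j' k' : ℕ}
    (hq : OccursAt u w q) (hmin : ∀ l < q, ¬ OccursAt u w l)
    (hk : OccursAt u w k) (hk' : OccursAt u w k')
    (hno : ∀ l, j < l → l < k → ¬ OccursAt u w l)
    (hsame : q < k - j → q < k' - j' → u (k - 1 - q) = u (k' - 1 - q))
    {r : ℕ} : r ≤ k - j → r ≤ k' - j' →
    ∀ l < r + w.length, u (k - r + l) = u (k' - r + l) := by
  induction r with
  | zero => exact fun _ _ l hl => hk'.iff_agree.1 hk l (by omega)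
  | succ r ih =>
    intro h1 h2
    have ih := ih (by omega) (by omega)
    have hlet : u (k - 1 - r) = u (k' - 1 - r) := by
      by_contra hne
      have hpre := hL (r + w.length) (k - 1 - r) (k' - 1 - r) (by
        rw [show k - 1 - r + 1 = k - r by omega, show k' - 1 - r + 1 = k' - r by omega]
        exact ih) hne
      rw [show k - 1 - r + 1 = k - r by omega] at hpre
      have hwr : OccursAt u w r := hk.of_agree fun l hl => by
        rw [← hpre _ (by omega)]
        congr 1
        omega
      have hqr : q ≤ r := not_lt.1 fun h => hmin r h hwr
      rcases hqr.eq_or_lt with rfl | hlt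
      · exact hne (hsame (by omega) (by omega))
      · refine hno (k - r + q) (by omega) (by omega) (hq.of_agree fun l hl => ?_)
        rw [Nat.add_assoc, hpre _ (by omega)]
    intro l hl
    rcases l with _ | l
    · convert hlet using 2 <;> omega
    · convert ih l (by omega) using 2 <;> omega

theorem length_le (hL : LeftSpecialsArePrefixes u) {w : List A} {q j k j' k' : ℕ}
    (hq : OccursAt u w q) (hmin : ∀ l < q, ¬ OccursAt u w l) (hjk : j < k)
    (hj : OccursAt u w j) (hk : OccursAt u w k) (hk' : OccursAt u w k')
    (hno : ∀ l, j < l → l < k → ¬ OccursAt u w l)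
    (hno' : ∀ l, j' < l → l < k' → ¬ OccursAt u w l)
    (hsame : q < k - j → q < k' - j' → u (k - 1 - q) = u (k' - 1 - q)) :
    k' - j' ≤ k - j := by
  by_contra! hlt
  have h := hL.agree_before hq hmin hk hk' hno hsame le_rfl hlt.le
  refine hno' (k' - (k - j)) (by omega) (by omega) (hj.of_agree fun l hl => ?_)
  rw [← h l (by omega)]
  congr 1
  omega

theorem propertyR [Fintype A] (hL : LeftSpecialsArePrefixes u)
    (H : PrefixesFullyLeftExtendable u) : PropertyR u (Fintype.card A) := by
  intro w hw
  obtain ⟨q, hq, hmin⟩ := isFactor_iff_exists_first.1 hw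
  choose f hf hfq _ using H.exists_returnWord_of_letter hq hmin
  have hinj : Function.Injective f := fun a b hab => by
    have := hfq a
    rw [hab, hfq b] at this
    exact (Option.some.inj this).symm
  have hrange : returnWords u w = Set.range f := by
    refine (Set.range_subset_iff.2 hf).antisymm' ?_
    rintro _ ⟨j, k, hjk, hj, hk, hno, rfl⟩
    obtain ⟨c, hc⟩ : ∃ c, q < k - j → u (k - 1 - q) = c := ⟨_, fun _ => rfl⟩
    refine ⟨c, ?_⟩
    have hcq := hfq c
    obtain ⟨j', k', hjk', hj', hk', hno', heq⟩ := hf c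
    rw [heq] at hcq ⊢
    have hsame : q < k - j → q < k' - j' → u (k - 1 - q) = u (k' - 1 - q) := by
      intro h1 h2
      rw [reverse_factorAt_getElem? h2] at hcq
      rw [hc h1, Option.some.inj hcq]
    have hle := hL.length_le hq hmin hjk hj hk hk' hno hno' hsame
    have hle' := hL.length_le hq hmin hjk' hj' hk' hk hno' hno fun h1 h2 => (hsame h2 h1).symm
    rw [hle.antisymm hle', factorAt_eq_iff]
    intro l hl
    have h := hL.agree_before hq hmin hk hk' hno hsame le_rfl hle' l (by omega)
    rw [show k - (k - j) = j by omega, show k' - (k - j) = j' by omega] at h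
    exact h.symm
  rw [hrange, ← Set.image_univ]
  refine ⟨Set.toFinite _, ?_⟩
  rw [Set.ncard_image_of_injective _ hinj, Set.ncard_univ, Nat.card_eq_fintype_card]

end LeftSpecialsArePrefixes

theorem finite_factors_of_length [Finite A] (u : ℕ → A) (n : ℕ) :
    {w : List A | w.length = n ∧ IsFactor u w}.Finite :=
  (List.finite_length_eq A n).subset fun _ h => h.1

theorem complexity_zero (u : ℕ → A) : Complexity u 0 = 1 := by
  rw [Complexity, Set.ncard_eq_one]
  refine ⟨[], Set.ext fun w => ?_⟩
  simp only [Set.mem_ofPred_eq, Set.mem_singleton_iff, List.length_eq_zero_iff]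
  refine ⟨fun h => h.1, ?_⟩
  rintro rfl
  exact ⟨rfl, 0, rfl⟩

theorem complexity_succ [Finite A] (u : ℕ → A) (n : ℕ) :
    Complexity u (n + 1) = ∑ w ∈ (finite_factors_of_length u n).toFinset, (leftExt u w).ncard := by
  classical
  rw [Complexity, Set.ncard_eq_toFinset_card _ (finite_factors_of_length u (n + 1)),
    Finset.card_eq_sum_card_fiberwise (f := List.tail)
      (t := (finite_factors_of_length u n).toFinset)]
  · refine Finset.sum_congr rfl fun w hw => ?_
    have hwn : w.length = n := by simp at hw; exact hw.1
    rw [← Set.ncard_coe_finset, ← Set.ncard_image_of_injective (leftExt u w)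
      (f := (· :: w)) (fun a b h => (List.cons.inj h).1)]
    congr 1
    ext v
    rcases v with _ | ⟨a, v⟩
    · simp
    · simp only [Finset.coe_filter, Set.Finite.mem_toFinset, Set.mem_ofPred_eq, List.length_cons,
        List.tail_cons, Set.mem_image, leftExt, List.cons.injEq]
      constructor
      · rintro ⟨⟨-, h⟩, rfl⟩
        exact ⟨a, h, rfl, rfl⟩
      · rintro ⟨b, h, rfl, rfl⟩
        exact ⟨⟨by omega, h⟩, rfl⟩
  · intro v hv
    rcases v with _ | ⟨a, v⟩
    · simp at hv
    · simp only [Set.Finite.coe_toFinset, Set.mem_ofPred_eq, List.length_cons, List.tail_cons,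
        Nat.add_right_cancel_iff] at hv ⊢
      obtain ⟨h, j, hj⟩ := hv
      exact ⟨h, j + 1, (occursAt_cons.1 hj).2⟩

theorem leftSpecialsArePrefixes_iff [Finite A] {u : ℕ → A} :
    LeftSpecialsArePrefixes u ↔ ∀ w, IsFactor u w → w ≠ factorAt u 0 w.length →
      (leftExt u w).ncard ≤ 1 := by
  simp only [Set.ncard_le_one (Set.toFinite _)]
  constructor
  · rintro hL w - hne a ⟨i, hi⟩ b ⟨j, hj⟩
    rw [occursAt_cons] at hi hj
    obtain ⟨rfl, hi⟩ := hi
    obtain ⟨rfl, hj⟩ := hj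
    by_contra hab
    refine hne ?_
    rw [← show factorAt u (i + 1) w.length = w from hi, length_factorAt, factorAt_eq_iff]
    simpa using hL _ i j (hj.iff_agree.1 hi) hab
  · intro h n i j hij hne
    by_contra hpre
    refine hne (h (factorAt u (i + 1) n) ⟨i + 1, by simp [OccursAt]⟩ ?_ _
      ⟨i, occursAt_cons.2 ⟨rfl, by simp [OccursAt]⟩⟩ _ ⟨j, occursAt_cons.2 ⟨rfl, ?_⟩⟩)
    · rw [length_factorAt, Ne, factorAt_eq_iff]
      simpa using hpre
    · rw [OccursAt, length_factorAt, factorAt_eq_iff]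
      exact fun l hl => (hij l hl).symm

namespace PrefixesFullyLeftExtendable

variable {u : ℕ → A}

theorem leftExt_prefix (H : PrefixesFullyLeftExtendable u) (n : ℕ) :
    leftExt u (factorAt u 0 n) = Set.univ := by
  refine Set.eq_univ_of_forall fun a => ?_
  obtain ⟨j, hj, hj'⟩ := H n a
  refine ⟨j, occursAt_cons.2 ⟨hj, ?_⟩⟩
  rw [OccursAt, length_factorAt, factorAt_eq_iff]
  simpa using hj'

theorem leftExt_nonempty (H : PrefixesFullyLeftExtendable u) {w : List A} (hw : IsFactor u w) :
    (leftExt u w).Nonempty := by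
  obtain ⟨i, hi⟩ := hw
  obtain ⟨j, -, hj⟩ := H (i + w.length) (u 0)
  refine ⟨u (j + i), j + i, occursAt_cons.2 ⟨rfl, hi.of_agree fun l hl => ?_⟩⟩
  rw [← hj (i + l) (by omega)]
  congr 1
  omega

theorem complexity_succ_eq_iff [Fintype A] (H : PrefixesFullyLeftExtendable u) (n : ℕ) :
    Complexity u (n + 1) + 1 = Complexity u n + Fintype.card A ↔
      ∀ w, w.length = n → IsFactor u w → w ≠ factorAt u 0 n → (leftExt u w).ncard = 1 := by
  classical
  have hp : factorAt u 0 n ∈ (finite_factors_of_length u n).toFinset := by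
    simp only [Set.Finite.mem_toFinset, Set.mem_ofPred_eq, length_factorAt, true_and]
    exact ⟨0, by simp [OccursAt]⟩
  have hC : Complexity u n = ((finite_factors_of_length u n).toFinset.erase
      (factorAt u 0 n)).card + 1 := by
    rw [Finset.card_erase_add_one hp, Complexity,
      Set.ncard_eq_toFinset_card _ (finite_factors_of_length u n)]
  have hle : ∀ w ∈ (finite_factors_of_length u n).toFinset.erase (factorAt u 0 n),
      1 ≤ (leftExt u w).ncard := by
    intro w hw
    simp only [Finset.mem_erase, Set.Finite.mem_toFinset, Set.mem_ofPred_eq] at hw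
    exact (Set.ncard_pos (Set.toFinite _)).2 (H.leftExt_nonempty hw.2.2)
  have hiff := Finset.sum_eq_sum_iff_of_le hle
  rw [complexity_succ, ← Finset.add_sum_erase _ _ hp, H.leftExt_prefix, Set.ncard_univ,
    Nat.card_eq_fintype_card, hC, Finset.card_eq_sum_ones]
  refine Iff.trans ⟨fun h => ?_, fun h => ?_⟩ (hiff.trans ⟨fun h w h1 h2 h3 => ?_, fun h w hw => ?_⟩)
  · omega
  · omega
  · exact (h w (by simp [h1, h2, h3])).symm
  · simp only [Finset.mem_erase, Set.Finite.mem_toFinset, Set.mem_ofPred_eq] at hw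
    exact (h w hw.2.1 hw.2.2 hw.1).symm

theorem leftSpecialsArePrefixes_iff_complexity [Fintype A] (H : PrefixesFullyLeftExtendable u) :
    LeftSpecialsArePrefixes u ↔ ∀ n, Complexity u n = (Fintype.card A - 1) * n + 1 := by
  have hpos : 0 < Fintype.card A := Fintype.card_pos_iff.2 ⟨u 0⟩
  have hstep : (∀ n, Complexity u n = (Fintype.card A - 1) * n + 1) ↔
      ∀ n, Complexity u (n + 1) + 1 = Complexity u n + Fintype.card A := by
    constructor
    · intro h n
      rw [h, h, Nat.mul_succ]
      omega
    · intro h n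
      induction n with
      | zero => simp [complexity_zero]
      | succ n ih =>
        have := h n
        rw [Nat.mul_succ]
        omega
  rw [hstep, leftSpecialsArePrefixes_iff]
  simp only [H.complexity_succ_eq_iff]
  constructor
  · rintro h _ w rfl hw hne
    exact (h w hw hne).antisymm ((Set.ncard_pos (Set.toFinite _)).2 (H.leftExt_nonempty hw))
  · exact fun h w hw hne => (h _ w rfl hw hne).le

theorem propertyR_iff_complexity [Fintype A] (H : PrefixesFullyLeftExtendable u) :
    PropertyR u (Fintype.card A) ↔ ∀ n, Complexity u n = (Fintype.card A - 1) * n + 1 :=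
  (Iff.intro H.leftSpecialsArePrefixes_of_propertyR fun h => h.propertyR H).trans
    H.leftSpecialsArePrefixes_iff_complexity

end PrefixesFullyLeftExtendable

theorem occursAt_append {u : ℕ → A} {x y : List A} {j : ℕ} :
    OccursAt u (x ++ y) j ↔ OccursAt u x j ∧ OccursAt u y (j + x.length) := by
  rw [OccursAt, List.length_append, factorAt_add]
  exact ⟨fun h => List.append_inj h (by simp), fun h => congrArg₂ _ h.1 h.2⟩

section Substitution

variable {u : ℕ → A} {σ : A → List A}

/-- The length of the image under `σ` of the prefix of `u` of length `j`. -/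
def imagePos (σ : A → List A) (u : ℕ → A) (j : ℕ) : ℕ :=
  ((factorAt u 0 j).flatMap σ).length

theorem imagePos_zero : imagePos σ u 0 = 0 := by
  simp [imagePos, factorAt]

theorem imagePos_succ (j : ℕ) : imagePos σ u (j + 1) = imagePos σ u j + (σ (u j)).length := by
  simp [imagePos, factorAt, List.range_succ]

theorem occursAt_flatMap (hfix : ∀ k, OccursAt u ((factorAt u 0 k).flatMap σ) 0) (j n : ℕ) :
    OccursAt u ((factorAt u j n).flatMap σ) (imagePos σ u j) := by
  have h := hfix (j + n)
  rw [factorAt_add, List.flatMap_append, occursAt_append] at h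
  simpa [imagePos] using h.2

/-- If the last letters of the images of letters are given by a map acting transitively on the
alphabet, then every prefix of the fixed point is extendable to the left by every letter. -/
theorem prefixesFullyLeftExtendable_of_fixedPoint {next : A → A}
    (hnext : ∀ a b, ∃ n, next^[n] a = b) (hlast : ∀ a, ∃ x, σ a = x ++ [next a])
    (hlen : 2 ≤ (σ (u 0)).length) (hfix : ∀ k, OccursAt u ((factorAt u 0 k).flatMap σ) 0) :
    PrefixesFullyLeftExtendable u := by
  have hpos : ∀ a, 1 ≤ (σ a).length := fun a => by
    obtain ⟨x, hx⟩ := hlast a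
    simp [hx]
  have hgrow : ∀ n, n + 2 ≤ imagePos σ u (n + 1) := by
    intro n
    induction n with
    | zero => simpa [imagePos_succ, imagePos_zero] using hlen
    | succ n ih =>
      have := hpos (u (n + 1))
      rw [imagePos_succ]
      omega
  have hnextAt : ∀ j, u (imagePos σ u (j + 1) - 1) = next (u j) := by
    intro j
    obtain ⟨x, hx⟩ := hlast (u j)
    have h := occursAt_flatMap hfix j 1
    simp only [factorAt, List.range_one, List.map_cons, Nat.add_zero, List.map_nil,
      List.flatMap_cons, List.flatMap_nil, List.append_nil, hx, occursAt_append,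
      occursAt_cons] at h
    rw [imagePos_succ, hx, ← h.2.1]
    simp [← Nat.add_assoc]
  have hagree : ∀ {j n}, (∀ l < n, u (j + l) = u l) →
      ∀ l < imagePos σ u n, u (imagePos σ u j + l) = u l := by
    intro j n h l hl
    have h1 := occursAt_flatMap hfix j n
    rw [show factorAt u j n = factorAt u 0 n from factorAt_eq_iff.2 (by simpa using h)] at h1
    simpa using (hfix n).iff_agree.1 h1 l hl
  have hret : ∃ j, u (j + 1) = u 0 := by
    have key : ∀ n, ∃ j, u (j + 1) = next^[n] (next (u 0)) := by
      intro n
      induction n with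
      | zero =>
        obtain ⟨d, hd⟩ := Nat.exists_eq_add_of_le (hgrow 0)
        refine ⟨d, ?_⟩
        rw [Function.iterate_zero_apply, ← hnextAt, hd]
        congr 1
        omega
      | succ n ih =>
        obtain ⟨j, hj⟩ := ih
        obtain ⟨d, hd⟩ := Nat.exists_eq_add_of_le (hgrow (j + 1))
        refine ⟨d + j + 1, ?_⟩
        rw [Function.iterate_succ_apply', ← hj, ← hnextAt, hd]
        congr 1
        omega
    obtain ⟨n, hn⟩ := hnext (next (u 0)) (u 0)
    exact hn ▸ key n
  have hocc : ∀ n, ∃ j, ∀ l < n + 1, u (j + 1 + l) = u l := by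
    intro n
    induction n with
    | zero => simpa using hret
    | succ n ih =>
      obtain ⟨j, hj⟩ := ih
      refine ⟨imagePos σ u (j + 1) - 1, fun l hl => ?_⟩
      have := hgrow j
      rw [Nat.sub_add_cancel (by omega)]
      exact hagree hj l (by have := hgrow n; omega)
  intro n a
  obtain ⟨j, hj⟩ := hocc n
  have key : ∀ k, ∃ i, u i = next^[k] (u j) ∧ ∀ l < n + 1, u (i + 1 + l) = u l := by
    intro k
    induction k with
    | zero => exact ⟨j, rfl, hj⟩
    | succ k ih =>
      obtain ⟨i, hi, hi'⟩ := ih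
      have := hgrow i
      refine ⟨imagePos σ u (i + 1) - 1, ?_, fun l hl => ?_⟩
      · rw [hnextAt, hi, Function.iterate_succ_apply']
      · rw [Nat.sub_add_cancel (by omega)]
        exact hagree hi' l (by have := hgrow n; omega)
  obtain ⟨k, hk⟩ := hnext (u j) a
  obtain ⟨i, hi, hi'⟩ := key k
  exact ⟨i, hi.trans hk, fun l hl => hi' l (by omega)⟩

end Substitution

theorem exists_iterate_finRotate (m : ℕ) (a b : Fin m) : ∃ n, (finRotate m)^[n] a = b := by
  rcases m with _ | m
  · exact a.elim0
  · refine ⟨(b - a).val, ?_⟩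
    have key : ∀ n : ℕ, (finRotate (m + 1))^[n] a = a + Fin.ofNat (m + 1) n := by
      intro n
      induction n with
      | zero => simp
      | succ n ih =>
        rw [Function.iterate_succ_apply', ih, finRotate_apply, add_assoc]
        congr 1
        ext
        simp [Fin.val_add]
    rw [key]
    simp

/-- Let `σ` be a primitive substitution on `{0, 1, …, m-1}` of the form
`σ(k) = 0^{t_{k+1}} (k+1)` for `0 ≤ k ≤ m-2` and `σ(m-1) = 0^{t_m}`, with `m ≥ 2`,
`t_1, t_m ≥ 1`. Then its fixed point `u = σ^∞(0)` satisfies property `R_m` if and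
only if `C(n) = (m-1) n + 1` for all `n ≥ 0`. -/
theorem betaSubstitution_propertyR_iff_complexity (m : ℕ) (hm : 2 ≤ m)
    (t : Fin m → ℕ) (ht1 : 1 ≤ t ⟨0, by omega⟩) (htm : 1 ≤ t ⟨m - 1, by omega⟩)
    (σ : Fin m → List (Fin m))
    (hσ : ∀ k : Fin m, ∀ h : (k : ℕ) + 1 < m,
      σ k = List.replicate (t k) ⟨0, by omega⟩ ++ [⟨(k : ℕ) + 1, h⟩])
    (hσlast : σ ⟨m - 1, by omega⟩ = List.replicate (t ⟨m - 1, by omega⟩) ⟨0, by omega⟩)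
    (hprim : ∃ n : ℕ, ∀ a b : Fin m, b ∈ (fun w : List (Fin m) => w.flatMap σ)^[n] [a])
    (u : ℕ → Fin m) (hu0 : u 0 = ⟨0, by omega⟩)
    (hfix : ∀ k : ℕ, OccursAt u ((factorAt u 0 k).flatMap σ) 0) :
    PropertyR u m ↔ ∀ n : ℕ, Complexity u n = (m - 1) * n + 1 := by
  have hrot : ∀ a : Fin m, ∃ x, σ a = x ++ [finRotate m a] := by
    intro a
    obtain ⟨m, rfl⟩ : ∃ k, m = k + 1 := ⟨m - 1, by omega⟩
    by_cases h : (a : ℕ) + 1 < m + 1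
    · refine ⟨List.replicate (t a) 0, (hσ a h).trans ?_⟩
      rw [finRotate_apply]
      congr 2
      ext
      rw [Fin.val_add_one_of_lt (by rw [Fin.lt_def, Fin.val_last]; omega)]
    · have ha : a = ⟨m + 1 - 1, by omega⟩ := by ext; simp; omega
      obtain ⟨d, hd⟩ := Nat.exists_eq_add_of_le' htm
      refine ⟨List.replicate d 0, (ha ▸ hσlast).trans ?_⟩
      rw [ha, hd, List.replicate_succ']
      congr 2
      exact finRotate_last.symm
  have hlen : 2 ≤ (σ (u 0)).length := by
    rw [hu0, hσ ⟨0, by omega⟩ (by simp; omega)]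
    simpa using ht1
  simpa using (prefixesFullyLeftExtendable_of_fixedPoint (exists_iterate_finRotate m) hrot hlen
    hfix).propertyR_iff_complexity
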